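/- arXiv:1911.00503 — 6 statements merged into one kernel-verified Lean document; each statement's English description precedes it below -/
import Mathlib

section
/- (Komatsu's lemma, Part I.) Let (a_k)_{k∈ℕ₀} be a sequence of nonnegative real numbers. The following two conditions are equivalent: (A₁) there exists h > 0 such that sup_{k∈ℕ₀} a_k / h^k < ∞; (B₁) for every (r_k) ∈ 𝔯, sup_{k∈ℕ₀} a_k / R_k < ∞, where (R_k) is the product sequence corresponding to (r_k). -/
open scoped ENNReal

noncomputable section

/-- The class 𝔯: positive sequences with `r 0 = 1`, monotonically increasing,
tending to infinity. -/
def IsRSeq (r : ℕ → ℝ) : Prop :=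
  r 0 = 1 ∧ (∀ p, 0 < r p) ∧ Monotone r ∧ Filter.Tendsto r Filter.atTop Filter.atTop

/-- The product sequence `R p = r 0 * r 1 * ⋯ * r p` (so `R 0 = r 0 = 1`). -/
def prodSeq (r : ℕ → ℝ) (p : ℕ) : ℝ := ∏ i ∈ Finset.range (p + 1), r i

/-- The one-dimensional operator `D_m = (1/i) ∂/∂x_m` acting on functions on `ℝ^d`. -/
def Dm {d : ℕ} (m : Fin d) (f : (Fin d → ℝ) → ℂ) : (Fin d → ℝ) → ℂ :=
  fun x => -Complex.I * fderiv ℝ f x (Pi.single m 1)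

/-- The multi-index derivative `D^k = D_1^{k_1} ⋯ D_d^{k_d}`. -/
def Dmulti {d : ℕ} (k : Fin d → ℕ) (f : (Fin d → ℝ) → ℂ) : (Fin d → ℝ) → ℂ :=
  ((List.ofFn fun m : Fin d => (Dm m)^[k m]).foldr (· ∘ ·) id) f

/-- An eventually bounded real sequence is bounded. -/
theorem bdd_of_eventually (u : ℕ → ℝ) (C : ℝ) (h : ∀ᶠ k in Filter.atTop, u k ≤ C) :
    ∃ C' : ℝ, ∀ k, u k ≤ C' := by
  have hb : Filter.IsBoundedUnder (· ≤ ·) Filter.atTop u := ⟨C, by simpa using h⟩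
  obtain ⟨C', hC'⟩ := hb.bddAbove_range
  exact ⟨C', fun k => hC' ⟨k, rfl⟩⟩

theorem prodSeq_pos {r : ℕ → ℝ} (hr : ∀ p, 0 < r p) (k : ℕ) : 0 < prodSeq r k :=
  Finset.prod_pos fun i _ => hr i

theorem prodSeq_succ (r : ℕ → ℝ) (k : ℕ) : prodSeq r (k + 1) = prodSeq r k * r (k + 1) :=
  Finset.prod_range_succ _ _

theorem komatsu_forward (a : ℕ → ℝ) (h : ℝ) (hh : 0 < h) (C : ℝ) (hC : ∀ k, a k / h ^ k ≤ C)
    (r : ℕ → ℝ) (hr : IsRSeq r) : ∃ C : ℝ, ∀ k : ℕ, a k / prodSeq r k ≤ C := by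
  obtain ⟨h0, hpos, hmono, hlim⟩ := hr
  obtain ⟨N, hN⟩ := Filter.eventually_atTop.1 (hlim.eventually_ge_atTop h)
  have key : ∀ k, N ≤ k → h ^ k / prodSeq r k ≤ h ^ N / prodSeq r N := by
    intro k hk
    induction k, hk using Nat.le_induction with
    | base => exact le_rfl
    | succ k hk ih =>
      refine le_trans ?_ ih
      rw [prodSeq_succ, pow_succ, mul_div_mul_comm]
      refine mul_le_of_le_one_right (div_nonneg (pow_pos hh k).le (prodSeq_pos hpos k).le) ?_
      exact (div_le_one (hpos _)).2 (hN _ (by omega))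
  refine bdd_of_eventually _ (|C| * (h ^ N / prodSeq r N)) ?_
  filter_upwards [Filter.eventually_ge_atTop N] with k hk
  have h1 : a k ≤ |C| * h ^ k :=
    (div_le_iff₀ (pow_pos hh k)).1 ((hC k).trans (le_abs_self C))
  calc a k / prodSeq r k ≤ (|C| * h ^ k) / prodSeq r k :=
        div_le_div_of_nonneg_right h1 (prodSeq_pos hpos k).le
    _ = |C| * (h ^ k / prodSeq r k) := mul_div_assoc _ _ _
    _ ≤ _ := mul_le_mul_of_nonneg_left (key k hk) (abs_nonneg C)

/-- `1 +` the number of `n` with `φ n < i` (for strictly monotone `φ`). -/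
def stepSeq (φ : ℕ → ℕ) (i : ℕ) : ℝ :=
  1 + (((Finset.range i).filter (fun n => φ n < i)).card : ℝ)

theorem stepSeq_le {φ : ℕ → ℕ} (hφ : StrictMono φ) {i n : ℕ} (h : i ≤ φ n) :
    stepSeq φ i ≤ (n : ℝ) + 1 := by
  have : ((Finset.range i).filter (fun n => φ n < i)).card ≤ (Finset.range n).card := by
    refine Finset.card_le_card fun m hm => ?_
    rw [Finset.mem_filter] at hm
    exact Finset.mem_range.2 (hφ.lt_iff_lt.1 (hm.2.trans_le h))
  rw [Finset.card_range] at this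
  have h2 : (((Finset.range i).filter (fun n => φ n < i)).card : ℝ) ≤ n := by exact_mod_cast this
  unfold stepSeq
  linarith

theorem stepSeq_isRSeq {φ : ℕ → ℕ} (hφ : StrictMono φ) : IsRSeq (stepSeq φ) := by
  have hm : Monotone (stepSeq φ) := by
    intro i j hij
    unfold stepSeq
    have : ((Finset.range i).filter (fun n => φ n < i)).card ≤
        ((Finset.range j).filter (fun n => φ n < j)).card := by
      refine Finset.card_le_card fun m hm => ?_
      simp only [Finset.mem_filter, Finset.mem_range] at hm ⊢
      omega
    have h2 : (((Finset.range i).filter (fun n => φ n < i)).card : ℝ) ≤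
        (((Finset.range j).filter (fun n => φ n < j)).card : ℝ) := by exact_mod_cast this
    linarith
  refine ⟨by simp [stepSeq], fun p => by unfold stepSeq; positivity, hm, ?_⟩
  refine Filter.tendsto_atTop_atTop_of_monotone hm fun b => ?_
  obtain ⟨n, hn⟩ := exists_nat_ge b
  refine ⟨φ n, ?_⟩
  have : (Finset.range n).card ≤ ((Finset.range (φ n)).filter (fun m => φ m < φ n)).card := by
    refine Finset.card_le_card fun m hm => ?_
    have h1 := hφ (Finset.mem_range.1 hm)
    have h2 := hφ.le_apply (x := m)
    simp only [Finset.mem_filter, Finset.mem_range]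
    omega
  rw [Finset.card_range] at this
  have h2 : (n : ℝ) ≤ (((Finset.range (φ n)).filter (fun m => φ m < φ n)).card : ℝ) := by
    exact_mod_cast this
  unfold stepSeq
  linarith

theorem prodSeq_le_pow {r : ℕ → ℝ} (hr : IsRSeq r) (c : ℝ) (k : ℕ) (h : ∀ i ≤ k, r i ≤ c) :
    prodSeq r k ≤ c ^ k := by
  unfold prodSeq
  rw [Finset.prod_range_succ', hr.1, mul_one]
  calc _ ≤ ∏ _i ∈ Finset.range k, c := by
        refine Finset.prod_le_prod (fun i _ => (hr.2.1 _).le) fun i hi => h _ ?_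
        have := Finset.mem_range.1 hi
        omega
    _ = c ^ k := by simp

theorem komatsu_backward (a : ℕ → ℝ) (ha : ∀ k, 0 ≤ a k)
    (H : ∀ r : ℕ → ℝ, IsRSeq r → ∃ C : ℝ, ∀ k : ℕ, a k / prodSeq r k ≤ C) :
    ∃ h : ℝ, 0 < h ∧ ∃ C : ℝ, ∀ k : ℕ, a k / h ^ k ≤ C := by
  by_contra hcon
  have hfreq : ∀ n : ℕ, ∃ᶠ k in Filter.atTop, (n : ℝ) < a k / ((n : ℝ) + 1) ^ k := by
    intro n hn
    refine hcon ⟨(n : ℝ) + 1, by positivity, bdd_of_eventually _ (n : ℝ) ?_⟩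
    filter_upwards [hn] with k hk using not_lt.1 hk
  obtain ⟨φ, hφ, hφa⟩ := Filter.extraction_forall_of_frequently hfreq
  have hR := stepSeq_isRSeq hφ
  obtain ⟨C, hC⟩ := H _ hR
  obtain ⟨n, hn⟩ := exists_nat_ge C
  have h1 := prodSeq_le_pow hR ((n : ℝ) + 1) (φ n) fun i hi => stepSeq_le hφ hi
  have h2 : a (φ n) / ((n : ℝ) + 1) ^ φ n ≤ a (φ n) / prodSeq (stepSeq φ) (φ n) :=
    div_le_div_of_nonneg_left (ha _) (prodSeq_pos hR.2.1 _) h1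
  have h3 := hφa n
  have h4 := hC (φ n)
  linarith

/-- Komatsu's lemma, Part I: for a sequence `(a k)` of nonnegative reals,
`∃ h > 0` with `sup_k a k / h^k < ∞` iff for every `(r k) ∈ 𝔯` one has
`sup_k a k / R k < ∞`, where `(R k)` is the corresponding product sequence. -/
theorem stmt1 (a : ℕ → ℝ) (ha : ∀ k, 0 ≤ a k) :
    (∃ h : ℝ, 0 < h ∧ ∃ C : ℝ, ∀ k : ℕ, a k / h ^ k ≤ C) ↔
      ∀ r : ℕ → ℝ, IsRSeq r → ∃ C : ℝ, ∀ k : ℕ, a k / prodSeq r k ≤ C := by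
  exact ⟨fun ⟨h, hh, C, hC⟩ r hr => komatsu_forward a h hh C hC r hr, komatsu_backward a ha⟩
end
end

section
/- (Komatsu's lemma, Part II.) Let (a_k)_{k∈ℕ₀} be a sequence of nonnegative real numbers. The following two conditions are equivalent: (A₂) for every h > 0, sup_{k∈ℕ₀} h^k · a_k < ∞; (B₂) there exists (r_k) ∈ 𝔯 such that sup_{k∈ℕ₀} R_k · a_k < ∞, where (R_k) is the product sequence corresponding to (r_k). -/
open scoped ENNReal

noncomputable section

/-- Komatsu's lemma, Part II: for a sequence `(a k)` of nonnegative reals,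
`sup_k h^k * a k < ∞` for every `h > 0` iff there exists `(r k) ∈ 𝔯` with
`sup_k R k * a k < ∞`, where `(R k)` is the corresponding product sequence. -/
theorem stmt2 (a : ℕ → ℝ) (ha : ∀ k, 0 ≤ a k) :
    (∀ h : ℝ, 0 < h → ∃ C : ℝ, ∀ k : ℕ, h ^ k * a k ≤ C) ↔
      ∃ r : ℕ → ℝ, IsRSeq r ∧ ∃ C : ℝ, ∀ k : ℕ, prodSeq r k * a k ≤ C := by
  classical
  constructor
  · intro H
    obtain ⟨C1, hC1⟩ := H 1 one_pos
    set C : ℝ := max 1 C1 with hC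
    let P : ℕ → ℕ → Prop := fun k n => ∀ j, k ≤ j → (n : ℝ) ^ j * a j ≤ C
    let m : ℕ → ℕ := fun k => Nat.findGreatest (P k) k
    have hm : Monotone m := by
      intro k l hkl
      exact Nat.findGreatest_mono (fun n hn j hj => hn j (hkl.trans hj)) hkl
    have hlim : ∀ n : ℕ, 1 ≤ n → ∃ N, ∀ k, N ≤ k → n ≤ m k := by
      intro n hn
      have hn' : (0 : ℝ) < n := by exact_mod_cast hn
      obtain ⟨D, hD⟩ := H (2 * n) (by positivity)
      obtain ⟨N, hN⟩ := pow_unbounded_of_one_lt D (one_lt_two : (1 : ℝ) < 2)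
      refine ⟨max n N, fun k hk => Nat.le_findGreatest (le_trans (le_max_left _ _) hk) ?_⟩
      intro j hj
      have hNj : N ≤ j := (le_max_right _ _).trans (hk.trans hj)
      have h1 : (2 : ℝ) ^ N ≤ 2 ^ j := pow_le_pow_right₀ one_le_two hNj
      have h2 := hD j
      rw [mul_pow, mul_assoc] at h2
      have h3 : (0 : ℝ) < 2 ^ j := by positivity
      have h4 : (n : ℝ) ^ j * a j ≤ 1 := by
        by_contra hcon
        push Not at hcon
        nlinarith
      exact h4.trans (le_max_left _ _)
    let r : ℕ → ℝ := fun k => ((max 1 (m k) : ℕ) : ℝ)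
    have hr1 : ∀ k, 1 ≤ r k := fun k => by
      simp only [r]
      exact_mod_cast le_max_left 1 (m k)
    have hr0 : r 0 = 1 := by simp [r, m]
    have hrm : Monotone r := fun k l hkl => by
      simp only [r]
      exact_mod_cast max_le_max le_rfl (hm hkl)
    refine ⟨r, ⟨hr0, fun p => one_pos.trans_le (hr1 p), hrm, ?_⟩, C, ?_⟩
    · rw [Filter.tendsto_atTop]
      intro b
      obtain ⟨n, hn⟩ := exists_nat_ge b
      obtain ⟨N, hN⟩ := hlim (n + 1) (by omega)
      filter_upwards [Filter.eventually_ge_atTop N] with k hk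
      refine hn.trans ?_
      have := hN k hk
      simp only [r]
      exact_mod_cast (by omega : n ≤ m k).trans (le_max_right _ _)
    · intro k
      have hR : prodSeq r k ≤ r k ^ k := by
        unfold prodSeq
        rw [Finset.prod_range_succ', hr0, mul_one]
        calc _ ≤ ∏ i ∈ Finset.range k, r k :=
              Finset.prod_le_prod (fun i _ => zero_le_one.trans (hr1 _))
                (fun i hi => hrm (by have := Finset.mem_range.1 hi; omega))
          _ = _ := by simp
      refine (mul_le_mul_of_nonneg_right hR (ha k)).trans ?_
      rcases Nat.lt_or_ge 1 (m k) with h | h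
      · have hP : P k (m k) := Nat.findGreatest_of_ne_zero (P := P k) rfl (by omega)
        have := hP k le_rfl
        simpa only [r, max_eq_right h.le] using this
      · have := (hC1 k).trans (le_max_right 1 C1)
        simpa only [r, max_eq_left h, Nat.cast_one] using this
  · rintro ⟨r, ⟨hr0, hpos, hmono, hlim⟩, C, hC⟩ h hh
    have hRpos : ∀ k, 0 < prodSeq r k := fun k => Finset.prod_pos fun i _ => hpos i
    obtain ⟨N, hN⟩ := Filter.eventually_atTop.1 (Filter.tendsto_atTop.1 hlim h)
    set K : ℝ := ∑ k ∈ Finset.range (N + 1), h ^ k / prodSeq r k with hK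
    have hnn : ∀ k, 0 ≤ h ^ k / prodSeq r k := fun k => by
      have := hRpos k
      positivity
    have hK0 : 0 ≤ K := Finset.sum_nonneg fun k _ => hnn k
    have hle : ∀ k, k ≤ N → h ^ k ≤ K * prodSeq r k := by
      intro k hk
      rw [← div_le_iff₀ (hRpos k)]
      exact Finset.single_le_sum (f := fun k => h ^ k / prodSeq r k) (fun i _ => hnn i)
        (Finset.mem_range.2 (by omega))
    have hall : ∀ k, h ^ k ≤ K * prodSeq r k := by
      intro k
      rcases le_total k N with hk | hk
      · exact hle k hk
      · induction k, hk using Nat.le_induction with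
        | base => exact hle N le_rfl
        | succ k hk ih =>
          have e : prodSeq r (k + 1) = prodSeq r k * r (k + 1) := by
            unfold prodSeq
            rw [Finset.prod_range_succ]
          rw [pow_succ, e, ← mul_assoc]
          exact mul_le_mul ih (hN _ (by omega)) hh.le (mul_nonneg hK0 (hRpos k).le)
    refine ⟨K * C, fun k => ?_⟩
    calc h ^ k * a k ≤ K * prodSeq r k * a k := mul_le_mul_of_nonneg_right (hall k) (ha k)
      _ = K * (prodSeq r k * a k) := by ring
      _ ≤ K * C := mul_le_mul_of_nonneg_left (hC k) hK0
end
end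

section
/- (d-dimensional Komatsu lemma, Part I.) Let d ≥ 1 and let (a_k)_{k∈ℕ₀^d} be a family of nonnegative real numbers indexed by multi-indices. The following two conditions are equivalent: (A₁) there exists h > 0 such that sup_{k∈ℕ₀^d} a_k / h^{|k|} < ∞; (B₁) for every (r_p) ∈ 𝔯, sup_{k∈ℕ₀^d} a_k / R_{|k|} < ∞, where (R_p) is the product sequence corresponding to (r_p). -/
open scoped ENNReal

noncomputable section

/-- `d`-dimensional Komatsu lemma, Part I: for a family `(a k)` of nonnegative
reals indexed by multi-indices `k ∈ ℕ₀^d`, `∃ h > 0` with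
`sup_k a k / h^(|k|) < ∞` iff for every `(r p) ∈ 𝔯` one has
`sup_k a k / R (|k|) < ∞`. -/
theorem stmt3 (d : ℕ) (hd : 1 ≤ d) (a : (Fin d → ℕ) → ℝ) (ha : ∀ k, 0 ≤ a k) :
    (∃ h : ℝ, 0 < h ∧ ∃ C : ℝ, ∀ k : Fin d → ℕ, a k / h ^ (∑ m, k m) ≤ C) ↔
      ∀ r : ℕ → ℝ, IsRSeq r → ∃ C : ℝ, ∀ k : Fin d → ℕ, a k / prodSeq r (∑ m, k m) ≤ C := by
  constructor
  · rintro ⟨h, hh, C, hC⟩ r ⟨_, hpos, _, ht⟩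
    have hRpos : ∀ n, 0 < prodSeq r n := fun n => Finset.prod_pos fun i _ => hpos i
    obtain ⟨N, hN⟩ := Filter.eventually_atTop.1 (ht.eventually_ge_atTop h)
    have hC0 : 0 ≤ C := le_trans (div_nonneg (ha 0) (by positivity)) (hC 0)
    have key : ∃ D : ℝ, ∀ n, h ^ n / prodSeq r n ≤ D := by
      refine ⟨∑ i ∈ Finset.range (N + 1), h ^ i / prodSeq r i, ?_⟩
      have small : ∀ n, n ≤ N →
          h ^ n / prodSeq r n ≤ ∑ i ∈ Finset.range (N + 1), h ^ i / prodSeq r i := by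
        intro n hn
        exact Finset.single_le_sum (f := fun i => h ^ i / prodSeq r i)
          (fun i _ => div_nonneg (by positivity) (hRpos i).le)
          (Finset.mem_range.2 (by omega))
      intro n
      induction n with
      | zero => exact small 0 (Nat.zero_le _)
      | succ n ih =>
        by_cases hn : n + 1 ≤ N
        · exact small _ hn
        · refine le_trans ?_ ih
          have e : prodSeq r (n + 1) = prodSeq r n * r (n + 1) := Finset.prod_range_succ _ _
          rw [e, pow_succ, mul_div_mul_comm]
          refine mul_le_of_le_one_right (div_nonneg (by positivity) (hRpos n).le) ?_
          exact (div_le_one (hpos _)).2 (hN _ (by omega))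
    obtain ⟨D, hD⟩ := key
    refine ⟨C * D, fun k => ?_⟩
    have hp : (0 : ℝ) < h ^ (∑ m, k m) := by positivity
    calc a k / prodSeq r (∑ m, k m)
        = (a k / h ^ (∑ m, k m)) * (h ^ (∑ m, k m) / prodSeq r (∑ m, k m)) := by
          have := (hRpos (∑ m, k m)).ne'
          field_simp
      _ ≤ C * D := mul_le_mul (hC k) (hD _) (div_nonneg hp.le (hRpos _).le) hC0
  · intro hB
    by_contra hA
    push Not at hA
    have hfreq : ∀ j : ℕ, ∃ᶠ n in Filter.atTop,
        ∃ k : Fin d → ℕ, ∑ m, k m = n ∧ (j : ℝ) < a k / ((j : ℝ) + 1) ^ n := by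
      intro j
      rw [Filter.frequently_atTop]
      intro N
      obtain ⟨k, hk⟩ := hA ((j : ℝ) + 1) (by positivity)
        (j + ∑ k ∈ Fintype.piFinset (fun _ : Fin d => Finset.range N), a k)
      have hs : 0 ≤ ∑ k ∈ Fintype.piFinset (fun _ : Fin d => Finset.range N), a k :=
        Finset.sum_nonneg fun k _ => ha k
      refine ⟨∑ m, k m, ?_, k, rfl, by linarith⟩
      by_contra hlt
      have hmem : k ∈ Fintype.piFinset (fun _ : Fin d => Finset.range N) := by
        rw [Fintype.mem_piFinset]
        intro m
        have := Finset.single_le_sum (f := k) (fun i _ => Nat.zero_le _) (Finset.mem_univ m)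
        exact Finset.mem_range.2 (by omega)
      have h1 := Finset.single_le_sum (f := a) (fun i _ => ha i) hmem
      have h2 : a k / ((j : ℝ) + 1) ^ (∑ m, k m) ≤ a k :=
        div_le_self (ha k) (one_le_pow₀ (by linarith [(Nat.cast_nonneg j : (0 : ℝ) ≤ j)]))
      linarith [(Nat.cast_nonneg j : (0 : ℝ) ≤ j)]
    obtain ⟨φ, hφ, hP⟩ := Filter.extraction_forall_of_frequently hfreq
    let c : ℕ → ℕ := fun p => ((Finset.range p).filter fun i => φ i < p).card
    have hmono : Monotone c := by
      intro p q hpq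
      refine Finset.card_le_card fun i hi => ?_
      simp only [Finset.mem_filter, Finset.mem_range] at hi ⊢
      omega
    have hup : ∀ j p, p ≤ φ j → c p ≤ j := by
      intro j p hp
      have : (Finset.range p).filter (fun i => φ i < p) ⊆ Finset.range j := by
        intro i hi
        simp only [Finset.mem_filter, Finset.mem_range] at hi ⊢
        exact hφ.lt_iff_lt.1 (by omega)
      simpa [c] using Finset.card_le_card this
    have hlow : ∀ j, j ≤ c (φ j) := by
      intro j
      have : Finset.range j ⊆ (Finset.range (φ j)).filter (fun i => φ i < φ j) := by
        intro i hi
        simp only [Finset.mem_filter, Finset.mem_range] at hi ⊢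
        have := hφ.id_le j
        simp only [id] at this
        exact ⟨by omega, hφ hi⟩
      simpa [c] using Finset.card_le_card this
    have hr : IsRSeq (fun p => (c p : ℝ) + 1) := by
      refine ⟨by simp [c], fun p => by positivity, ?_, ?_⟩
      · intro p q hpq
        have : (c p : ℝ) ≤ c q := by exact_mod_cast hmono hpq
        simpa using this
      · refine Filter.tendsto_atTop_add_const_right _ _ ?_
        refine tendsto_natCast_atTop_atTop.comp ?_
        exact Filter.tendsto_atTop_atTop_of_monotone hmono fun j => ⟨φ j, hlow j⟩
    obtain ⟨C, hC⟩ := hB _ hr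
    obtain ⟨j, hj⟩ := exists_nat_gt C
    obtain ⟨k, hk, hlt⟩ := hP j
    have hCk := hC k
    rw [hk] at hCk
    have hR0 : 0 < prodSeq (fun p => (c p : ℝ) + 1) (φ j) :=
      Finset.prod_pos fun i _ => by positivity
    have hR : prodSeq (fun p => (c p : ℝ) + 1) (φ j) ≤ ((j : ℝ) + 1) ^ (φ j) := by
      unfold prodSeq
      rw [Finset.prod_range_succ']
      have h0 : ((c 0 : ℕ) : ℝ) + 1 = 1 := by simp [c]
      rw [h0, mul_one]
      calc _ ≤ ∏ i ∈ Finset.range (φ j), ((j : ℝ) + 1) := by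
            refine Finset.prod_le_prod (fun i _ => by positivity) fun i hi => ?_
            have : (c (i + 1) : ℝ) ≤ j := by
              exact_mod_cast hup j (i + 1) (Finset.mem_range.1 hi)
            linarith
        _ = _ := by simp
    have := div_le_div_of_nonneg_left (ha k) hR0 hR
    linarith
end
end

section
/- (d-dimensional Komatsu lemma, Part II.) Let d ≥ 1 and let (a_k)_{k∈ℕ₀^d} be a family of nonnegative real numbers indexed by multi-indices. The following two conditions are equivalent: (A₂) for every h > 0, sup_{k∈ℕ₀^d} h^{|k|} · a_k < ∞; (B₂) there exists (r_p) ∈ 𝔯 such that sup_{k∈ℕ₀^d} R_{|k|} · a_k < ∞, where (R_p) is the product sequence corresponding to (r_p). -/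
open scoped ENNReal

noncomputable section

lemma prodSeq_succ_aux (r : ℕ → ℝ) (p : ℕ) : prodSeq r (p + 1) = prodSeq r p * r (p + 1) := by
  simp only [prodSeq]
  rw [Finset.prod_range_succ]

lemma prodSeq_pos_aux (r : ℕ → ℝ) (hr : ∀ p, 0 < r p) (p : ℕ) : 0 < prodSeq r p :=
  Finset.prod_pos fun i _ => hr i

lemma prodSeq_le_aux (r : ℕ → ℝ) (hr : IsRSeq r) (p : ℕ) : prodSeq r p ≤ r p ^ p := by
  obtain ⟨h0, hpos, hm, -⟩ := hr
  rw [prodSeq, Finset.prod_range_succ', h0, mul_one]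
  calc _ ≤ ∏ i ∈ Finset.range p, r p := by
        apply Finset.prod_le_prod
        · intro i _
          exact (hpos _).le
        · intro i hi
          exact hm (Finset.mem_range.mp hi)
    _ = _ := by simp

lemma pow_le_prodSeq_aux (r : ℕ → ℝ) (hr : IsRSeq r) (h : ℝ) (hh : 0 < h) :
    ∃ M : ℝ, 0 ≤ M ∧ ∀ p, h ^ p ≤ M * prodSeq r p := by
  obtain ⟨h0, hpos, hm, ht⟩ := hr
  obtain ⟨N, hN⟩ := Filter.eventually_atTop.mp (ht.eventually_ge_atTop h)
  have hR := prodSeq_pos_aux r hpos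
  set M := ∑ i ∈ Finset.range (N + 1), h ^ i / prodSeq r i with hM
  have hnn : ∀ i, 0 ≤ h ^ i / prodSeq r i := fun i => (div_pos (pow_pos hh i) (hR i)).le
  have hM0 : 0 ≤ M := Finset.sum_nonneg fun i _ => hnn i
  have small : ∀ p, p ≤ N → h ^ p ≤ M * prodSeq r p := by
    intro p hp
    rw [← div_le_iff₀ (hR p)]
    exact Finset.single_le_sum (f := fun i => h ^ i / prodSeq r i) (fun i _ => hnn i)
      (Finset.mem_range.mpr (by omega))
  refine ⟨M, hM0, fun p => ?_⟩
  induction p with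
  | zero => exact small 0 (Nat.zero_le _)
  | succ p ih =>
    by_cases hp : p + 1 ≤ N
    · exact small _ hp
    · rw [prodSeq_succ_aux, pow_succ, ← mul_assoc]
      exact mul_le_mul ih (hN _ (by omega)) hh.le (mul_nonneg hM0 (hR p).le)

/-- `d`-dimensional Komatsu lemma, Part II: for a family `(a k)` of nonnegative
reals indexed by multi-indices `k ∈ ℕ₀^d`, `sup_k h^(|k|) * a k < ∞` for every
`h > 0` iff there exists `(r p) ∈ 𝔯` with `sup_k R (|k|) * a k < ∞`. -/
theorem stmt4 (d : ℕ) (hd : 1 ≤ d) (a : (Fin d → ℕ) → ℝ) (ha : ∀ k, 0 ≤ a k) :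
    (∀ h : ℝ, 0 < h → ∃ C : ℝ, ∀ k : Fin d → ℕ, h ^ (∑ m, k m) * a k ≤ C) ↔
      ∃ r : ℕ → ℝ, IsRSeq r ∧ ∃ C : ℝ, ∀ k : Fin d → ℕ, prodSeq r (∑ m, k m) * a k ≤ C := by
  constructor
  · intro H
    have key : ∀ n : ℕ, ∃ N : ℕ, ∀ k : Fin d → ℕ, N ≤ ∑ m, k m →
        ((n : ℝ) + 1) ^ (∑ m, k m) * a k ≤ 1 := by
      intro n
      obtain ⟨C, hC⟩ := H (2 * ((n : ℝ) + 1)) (by positivity)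
      obtain ⟨N, hN⟩ := pow_unbounded_of_one_lt C (one_lt_two : (1 : ℝ) < 2)
      refine ⟨N, fun k hk => ?_⟩
      have h1 := hC k
      rw [mul_pow, mul_assoc] at h1
      have h2 : (2 : ℝ) ^ N ≤ 2 ^ (∑ m, k m) := pow_le_pow_right₀ (by norm_num) hk
      have h3 : (0 : ℝ) < 2 ^ (∑ m, k m) := by positivity
      by_contra hcon
      push Not at hcon
      nlinarith
    choose N hN using key
    set g : ℕ → ℕ := fun p => Nat.findGreatest (fun n => N n ≤ p) p with hg
    have hgm : Monotone g := fun p q hpq =>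
      Nat.findGreatest_mono (fun n hn => le_trans hn hpq) hpq
    have hr : IsRSeq (fun p => (g p : ℝ) + 1) := by
      refine ⟨by simp [hg], fun p => by positivity, ?_, ?_⟩
      · intro p q hpq
        have : (g p : ℝ) ≤ g q := by exact_mod_cast hgm hpq
        simpa using this
      · apply Filter.tendsto_atTop_add_const_right
        apply tendsto_natCast_atTop_atTop.comp
        refine Filter.tendsto_atTop_atTop.mpr fun n => ⟨max n (N n), fun p hp => ?_⟩
        exact Nat.le_findGreatest (le_trans (le_max_left _ _) hp) (le_trans (le_max_right _ _) hp)
    obtain ⟨C, hC⟩ := H 1 one_pos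
    refine ⟨_, hr, max C 1, fun k => ?_⟩
    refine le_trans (mul_le_mul_of_nonneg_right (prodSeq_le_aux _ hr _) (ha k)) ?_
    by_cases h0 : g (∑ m, k m) = 0
    · refine le_trans ?_ (le_max_left _ _)
      simpa [h0] using hC k
    · refine le_trans ?_ (le_max_right _ _)
      exact hN _ k (Nat.findGreatest_of_ne_zero (P := fun n => N n ≤ ∑ m, k m) rfl h0)
  · rintro ⟨r, hr, C, hC⟩ h hh
    obtain ⟨M, hM0, hM⟩ := pow_le_prodSeq_aux r hr h hh
    refine ⟨M * C, fun k => ?_⟩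
    calc _ ≤ M * prodSeq r (∑ m, k m) * a k := mul_le_mul_of_nonneg_right (hM _) (ha k)
      _ = M * (prodSeq r (∑ m, k m) * a k) := by ring
      _ ≤ _ := mul_le_mul_of_nonneg_left (hC k) hM0
end
end

section
/- For every sequence (s_p) ∈ 𝔯 there exists a sequence (r_p) ∈ 𝔯 such that r_p ≤ s_p for all p ∈ ℕ and such that the corresponding product sequence (R_p) satisfies R_{p+q} ≤ 2^{p+q} · R_p · R_q for all p, q ∈ ℕ₀. -/
open scoped ENNReal

noncomputable section

/-- Auxiliary sequence: `r 0 = 1`, `r (p+1) = min (s (p+1)) (r p * (p+2)/(p+1))`. -/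
def auxR (s : ℕ → ℝ) : ℕ → ℝ
  | 0 => 1
  | p + 1 => min (s (p + 1)) (auxR s p * (((p : ℝ) + 2) / ((p : ℝ) + 1)))

lemma auxR_succ (s : ℕ → ℝ) (p : ℕ) :
    auxR s (p + 1) = min (s (p + 1)) (auxR s p * (((p : ℝ) + 2) / ((p : ℝ) + 1))) := rfl

lemma auxR_le (s : ℕ → ℝ) (h0 : s 0 = 1) (p : ℕ) : auxR s p ≤ s p := by
  cases p with
  | zero => simp [auxR, h0]
  | succ p => rw [auxR_succ]; exact min_le_left _ _

lemma auxR_pos (s : ℕ → ℝ) (hpos : ∀ p, 0 < s p) (p : ℕ) : 0 < auxR s p := by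
  induction p with
  | zero => simp [auxR]
  | succ p ih => rw [auxR_succ]; exact lt_min (hpos _) (by positivity)

lemma auxR_mono (s : ℕ → ℝ) (h0 : s 0 = 1) (hpos : ∀ p, 0 < s p) (hm : Monotone s) :
    Monotone (auxR s) := by
  refine monotone_nat_of_le_succ fun p => ?_
  rw [auxR_succ]
  refine le_min ((auxR_le s h0 p).trans (hm (Nat.le_succ p))) ?_
  refine le_mul_of_one_le_right (auxR_pos s hpos p).le ?_
  rw [le_div_iff₀ (by positivity)]
  linarith

lemma auxR_lower (s : ℕ → ℝ) (hm : Monotone s) (hpos : ∀ p, 0 < s p) (N k : ℕ) :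
    min (s N) (auxR s N * (((N + k : ℕ) : ℝ) + 1) / ((N : ℝ) + 1)) ≤ auxR s (N + k) := by
  induction k with
  | zero =>
    refine (min_le_right _ _).trans (le_of_eq ?_)
    have : (N : ℝ) + 1 ≠ 0 := by positivity
    simp only [add_zero]
    field_simp
  | succ k ih =>
    rw [← add_assoc, auxR_succ]
    refine le_min ((min_le_left _ _).trans (hm (by omega))) ?_
    have hp := auxR_pos s hpos (N + k)
    have hN := auxR_pos s hpos N
    rcases min_le_iff.1 ih with h | h
    · refine (min_le_left _ _).trans (h.trans (le_mul_of_one_le_right hp.le ?_))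
      rw [le_div_iff₀ (by positivity)]
      linarith
    · refine (min_le_right _ _).trans ?_
      refine le_trans (le_of_eq ?_) (mul_le_mul_of_nonneg_right h (by positivity))
      push_cast
      have h1 : (N : ℝ) + 1 ≠ 0 := by positivity
      have h2 : (N : ℝ) + k + 1 ≠ 0 := by positivity
      field_simp
      ring

lemma auxR_upper (s : ℕ → ℝ) (N k : ℕ) :
    auxR s (N + k) * ((N : ℝ) + 1) ≤ auxR s N * (((N + k : ℕ) : ℝ) + 1) := by
  induction k with
  | zero => simp
  | succ k ih =>
    have h := min_le_right (s (N + k + 1))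
      (auxR s (N + k) * ((((N + k : ℕ) : ℝ) + 2) / (((N + k : ℕ) : ℝ) + 1)))
    rw [← auxR_succ] at h
    have hc : (0 : ℝ) < ((N + k : ℕ) : ℝ) + 1 := by positivity
    have e : auxR s N * (((N + (k + 1) : ℕ) : ℝ) + 1) =
        auxR s N * (((N + k : ℕ) : ℝ) + 1) *
          ((((N + k : ℕ) : ℝ) + 2) / (((N + k : ℕ) : ℝ) + 1)) := by
      have : (((N + (k + 1) : ℕ) : ℝ) + 1) = ((N + k : ℕ) : ℝ) + 2 := by push_cast; ring
      rw [this]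
      field_simp
    rw [e]
    calc auxR s (N + (k + 1)) * ((N : ℝ) + 1)
        ≤ (auxR s (N + k) * ((((N + k : ℕ) : ℝ) + 2) / (((N + k : ℕ) : ℝ) + 1)))
            * ((N : ℝ) + 1) := mul_le_mul_of_nonneg_right h (by positivity)
      _ = auxR s (N + k) * ((N : ℝ) + 1)
            * ((((N + k : ℕ) : ℝ) + 2) / (((N + k : ℕ) : ℝ) + 1)) := by ring
      _ ≤ _ := mul_le_mul_of_nonneg_right ih (by positivity)

lemma auxR_step (s : ℕ → ℝ) (hpos : ∀ p, 0 < s p) (p q : ℕ) :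
    auxR s (p + q + 1) * ((q : ℝ) + 1) ≤ auxR s (q + 1) * ((p : ℝ) + q + 1) := by
  have h := auxR_upper s (q + 1) p
  rw [show q + 1 + p = p + q + 1 by ring] at h
  push_cast at h
  have hq := auxR_pos s hpos (q + 1)
  have hp : (0 : ℝ) ≤ p := by positivity
  have hq0 : (0 : ℝ) ≤ q := by positivity
  have h2 : (0 : ℝ) < (q : ℝ) + 1 + 1 := by positivity
  have h3 : (auxR s (p + q + 1) * ((q : ℝ) + 1)) * ((q : ℝ) + 1 + 1) ≤
      (auxR s (q + 1) * ((p : ℝ) + q + 1)) * ((q : ℝ) + 1 + 1) := by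
    nlinarith [mul_le_mul_of_nonneg_right h (by positivity : (0 : ℝ) ≤ (q : ℝ) + 1),
      mul_nonneg hq.le hp]
  exact le_of_mul_le_mul_right h3 h2

lemma prodSeq_choose (s : ℕ → ℝ) (hpos : ∀ p, 0 < s p) (p q : ℕ) :
    prodSeq (auxR s) (p + q) ≤
      ((p + q).choose q : ℝ) * prodSeq (auxR s) p * prodSeq (auxR s) q := by
  have hP : ∀ n, 0 < prodSeq (auxR s) n := fun n =>
    Finset.prod_pos fun i _ => auxR_pos s hpos i
  have hS : ∀ n, prodSeq (auxR s) (n + 1) = prodSeq (auxR s) n * auxR s (n + 1) := fun n =>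
    Finset.prod_range_succ _ _
  induction q with
  | zero => simp [prodSeq, auxR]
  | succ q ih =>
    rw [← add_assoc, hS, hS]
    have hc : (((p + q + 1).choose (q + 1) : ℕ) : ℝ) * ((q : ℝ) + 1) =
        ((p : ℝ) + q + 1) * ((p + q).choose q : ℝ) := by
      have := Nat.add_one_mul_choose_eq (p + q) q
      exact_mod_cast this.symm
    have hq : (0 : ℝ) < (q : ℝ) + 1 := by positivity
    have hst := auxR_step s hpos p q
    refine le_of_mul_le_mul_right ?_ hq
    have hPp := hP p
    have hPq := hP q
    calc prodSeq (auxR s) (p + q) * auxR s (p + q + 1) * ((q : ℝ) + 1)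
        = prodSeq (auxR s) (p + q) * (auxR s (p + q + 1) * ((q : ℝ) + 1)) := by ring
      _ ≤ (((p + q).choose q : ℝ) * prodSeq (auxR s) p * prodSeq (auxR s) q) *
          (auxR s (q + 1) * ((p : ℝ) + q + 1)) := by
          refine mul_le_mul ih hst ?_ (by positivity)
          exact mul_nonneg (auxR_pos s hpos _).le hq.le
      _ = (((p : ℝ) + q + 1) * ((p + q).choose q : ℝ)) * prodSeq (auxR s) p *
          (prodSeq (auxR s) q * auxR s (q + 1)) := by ring
      _ = _ := by rw [← hc]; ring

/-- For every `(s_p) ∈ 𝔯` there exists `(r_p) ∈ 𝔯` with `r p ≤ s p` for `p ≥ 1`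
whose product sequence satisfies `R (p+q) ≤ 2^(p+q) * R p * R q`. -/
theorem stmt11 (s : ℕ → ℝ) (hs : IsRSeq s) :
    ∃ r : ℕ → ℝ, IsRSeq r ∧ (∀ p : ℕ, 1 ≤ p → r p ≤ s p) ∧
      ∀ p q : ℕ, prodSeq r (p + q) ≤ 2 ^ (p + q) * prodSeq r p * prodSeq r q := by
  obtain ⟨h0, hpos, hm, ht⟩ := hs
  have hmono := auxR_mono s h0 hpos hm
  refine ⟨auxR s, ⟨rfl, auxR_pos s hpos, hmono, ?_⟩, fun p _ => auxR_le s h0 p, ?_⟩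
  · refine Filter.tendsto_atTop_atTop_of_monotone hmono fun M => ?_
    obtain ⟨N, hN⟩ := (ht.eventually_ge_atTop M).exists
    obtain ⟨k, hk⟩ := exists_nat_ge (M * ((N : ℝ) + 1))
    refine ⟨N + k, le_trans (le_min hN ?_) (auxR_lower s hm hpos N k)⟩
    rw [le_div_iff₀ (by positivity)]
    have h1 : 1 ≤ auxR s N := hmono (Nat.zero_le N)
    refine hk.trans ?_
    have h2 : (k : ℝ) ≤ ((N + k : ℕ) : ℝ) + 1 := by
      push_cast
      have : (0 : ℝ) ≤ N := by positivity
      linarith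
    exact h2.trans (le_mul_of_one_le_left (by positivity) h1)
  · intro p q
    have hP : ∀ n, 0 < prodSeq (auxR s) n := fun n =>
      Finset.prod_pos fun i _ => auxR_pos s hpos i
    refine (prodSeq_choose s hpos p q).trans ?_
    have hc : ((p + q).choose q : ℝ) ≤ 2 ^ (p + q) := by
      exact_mod_cast Nat.choose_le_two_pow (p + q) q
    exact mul_le_mul_of_nonneg_right (mul_le_mul_of_nonneg_right hc (hP p).le) (hP q).le
end
end

section
/- Let (M_p)_{p∈ℕ₀} be a sequence of positive real numbers and let (c_k)_{k∈ℕ₀^d} be a family of complex numbers. Then the following are equivalent: (i) for every L > 0 there is a constant C_L > 0 such that |c_k| ≤ C_L · L^{|k|} / M_{|k|} for all k ∈ ℕ₀^d; (ii) there exist C > 0 and a sequence (u_p) ∈ 𝔯 such that |c_k| ≤ C / (U_{|k|} · M_{|k|}) for all k ∈ ℕ₀^d, where (U_p) is the product sequence corresponding to (u_p). (Either condition characterizes the coefficients of an ultradifferential operator P(D) = Σ_{k∈ℕ₀^d} c_k D^k of class {M_p}.) -/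
open scoped ENNReal

noncomputable section

lemma exists_pos_lower (f : ℕ → ℝ) (hf : ∀ p, 0 < f p) (n : ℕ) :
    ∃ m : ℝ, 0 < m ∧ ∀ p ≤ n, m ≤ f p := by
  induction n with
  | zero =>
    refine ⟨f 0, hf 0, fun p hp => ?_⟩
    obtain rfl : p = 0 := by omega
    exact le_rfl
  | succ n ih =>
    obtain ⟨m, hm, h⟩ := ih
    refine ⟨min m (f (n + 1)), lt_min hm (hf _), fun p hp => ?_⟩
    rcases Nat.lt_or_ge n p with h1 | h1
    · obtain rfl : p = n + 1 := by omega
      exact min_le_right _ _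
    · exact (min_le_left _ _).trans (h p h1)

lemma exists_lower (u : ℕ → ℝ) (hu : IsRSeq u) (L : ℝ) (hL : 0 < L) :
    ∃ m : ℝ, 0 < m ∧ ∀ p, m ≤ L ^ p * prodSeq u p := by
  obtain ⟨-, hpos, -, ht⟩ := hu
  have hU : ∀ p, 0 < prodSeq u p := fun p => Finset.prod_pos fun i _ => hpos i
  have hf : ∀ p, 0 < L ^ p * prodSeq u p := fun p => mul_pos (pow_pos hL p) (hU p)
  obtain ⟨N, hN⟩ := Filter.eventually_atTop.1 (ht.eventually_ge_atTop (1 / L))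
  obtain ⟨m, hm, h⟩ := exists_pos_lower _ hf N
  refine ⟨m, hm, fun p => ?_⟩
  rcases le_total p N with h1 | h1
  · exact h p h1
  · induction p, h1 using Nat.le_induction with
    | base => exact h N le_rfl
    | succ p hp ih =>
      have e : L ^ (p + 1) * prodSeq u (p + 1) = (L ^ p * prodSeq u p) * (L * u (p + 1)) := by
        rw [prodSeq, Finset.prod_range_succ, ← prodSeq]; ring
      have h2 : 1 ≤ L * u (p + 1) := by
        have := hN (p + 1) (by omega)
        rw [div_le_iff₀ hL] at this
        linarith
      rw [e]
      exact ih.trans (le_mul_of_one_le_right (hf p).le h2)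

lemma exists_seq (C : ℕ → ℝ) (hC : ∀ v, 0 < C v) :
    ∃ A : ℝ, 0 < A ∧ ∃ u : ℕ → ℝ, IsRSeq u ∧
      ∀ p, ∃ v, C v * (1 / (2 * ((v : ℝ) + 1))) ^ p * prodSeq u p ≤ A := by
  classical
  let g : ℕ → ℕ := fun p => Nat.findGreatest (fun v => C v ≤ 2 ^ p) p
  have hg : Monotone g := by
    intro p q hpq
    refine Nat.findGreatest_mono (fun v hv => ?_) hpq
    exact le_trans hv (pow_le_pow_right₀ (by norm_num) hpq)
  have hg0 : g 0 = 0 := Nat.findGreatest_zero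
  have hgC : ∀ p, C (g p) ≤ (1 + C 0) * 2 ^ p := by
    intro p
    have h1 : (1 : ℝ) ≤ 2 ^ p := one_le_pow₀ (by norm_num)
    by_cases h : g p = 0
    · rw [h]; nlinarith [hC 0]
    · have : C (g p) ≤ 2 ^ p := Nat.findGreatest_of_ne_zero (P := fun v => C v ≤ 2 ^ p) rfl h
      nlinarith [hC 0]
  have hgt : Filter.Tendsto g Filter.atTop Filter.atTop := by
    refine Filter.tendsto_atTop.2 fun v => ?_
    have := (tendsto_pow_atTop_atTop_of_one_lt (r := (2 : ℝ)) (by norm_num)).eventually_ge_atTop (C v)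
    filter_upwards [this, Filter.eventually_ge_atTop v] with p h1 h2
    exact Nat.le_findGreatest h2 h1
  refine ⟨1 + C 0, by linarith [hC 0], fun p => (g p : ℝ) + 1, ⟨by simp [hg0], fun p => by positivity,
    fun p q h => by have := hg h; simpa using this, ?_⟩, fun p => ⟨g p, ?_⟩⟩
  · exact Filter.tendsto_atTop_add_const_right _ _ (tendsto_natCast_atTop_atTop.comp hgt)
  · have hU : prodSeq (fun p => (g p : ℝ) + 1) p ≤ ((g p : ℝ) + 1) ^ p := by
      rw [prodSeq, Finset.prod_range_succ']
      simp only [hg0, Nat.cast_zero, zero_add, mul_one]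
      calc _ ≤ ∏ i ∈ Finset.range p, ((g p : ℝ) + 1) := by
            refine Finset.prod_le_prod (fun i _ => by positivity) fun i hi => ?_
            have := hg (show i + 1 ≤ p from Finset.mem_range.1 hi)
            have : (g (i + 1) : ℝ) ≤ g p := by exact_mod_cast this
            linarith
        _ = _ := by simp
    have hx : (0 : ℝ) < (g p : ℝ) + 1 := by positivity
    calc _ ≤ C (g p) * (1 / (2 * ((g p : ℝ) + 1))) ^ p * ((g p : ℝ) + 1) ^ p := by
          have := hC (g p)
          gcongr
      _ = C (g p) / 2 ^ p := by
          rw [mul_assoc, ← mul_pow]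
          have : 1 / (2 * ((g p : ℝ) + 1)) * ((g p : ℝ) + 1) = 1 / 2 := by field_simp
          rw [this, one_div, inv_pow, div_eq_mul_inv]
      _ ≤ _ := by
          rw [div_le_iff₀ (by positivity)]
          exact hgC p

/-- Characterization of coefficients of an ultradifferential operator of class
`{M_p}`: `(∀ L > 0, ∃ C_L > 0, |c_k| ≤ C_L L^{|k|} / M_{|k|})` iff there exist
`C > 0` and `(u_p) ∈ 𝔯` with `|c_k| ≤ C / (U_{|k|} M_{|k|})`. -/
theorem stmt12 (d : ℕ) (M : ℕ → ℝ) (hM : ∀ p, 0 < M p) (c : (Fin d → ℕ) → ℂ) :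
    (∀ L : ℝ, 0 < L → ∃ C : ℝ, 0 < C ∧
        ∀ k : Fin d → ℕ, ‖c k‖ ≤ C * L ^ (∑ m, k m) / M (∑ m, k m)) ↔
      ∃ C : ℝ, 0 < C ∧ ∃ u : ℕ → ℝ, IsRSeq u ∧
        ∀ k : Fin d → ℕ, ‖c k‖ ≤ C / (prodSeq u (∑ m, k m) * M (∑ m, k m)) := by
  constructor
  · intro h
    choose C hC hb using fun v : ℕ => h (1 / (2 * ((v : ℝ) + 1))) (by positivity)
    obtain ⟨A, hA, u, hu, hAu⟩ := exists_seq C hC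
    refine ⟨A, hA, u, hu, fun k => ?_⟩
    have hU : 0 < prodSeq u (∑ m, k m) := Finset.prod_pos fun i _ => hu.2.1 i
    obtain ⟨v, hv⟩ := hAu (∑ m, k m)
    refine (hb v k).trans ?_
    rw [← div_div _ (prodSeq u _)]
    refine div_le_div_of_nonneg_right ?_ (hM _).le
    rwa [le_div_iff₀ hU]
  · rintro ⟨C, hC, u, hu, hb⟩ L hL
    obtain ⟨m, hm, h⟩ := exists_lower u hu L hL
    refine ⟨C / m, by positivity, fun k => (hb k).trans ?_⟩
    have hU : 0 < prodSeq u (∑ m, k m) := Finset.prod_pos fun i _ => hu.2.1 i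
    rw [← div_div _ (prodSeq u _)]
    refine div_le_div_of_nonneg_right ?_ (hM _).le
    rw [div_le_iff₀ hU, div_mul_eq_mul_div, div_mul_eq_mul_div, le_div_iff₀ hm, mul_assoc]
    exact mul_le_mul_of_nonneg_left (h _) hC.le
end
end
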